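/- Let T ⊆ [M]^n be a type promise, f : T → Bool, and x ∈ T. If b ⊆ Fin n is a sensitive block of x that is minimal under inclusion (no proper subset of b is a sensitive block of x), then |b| ≤ 3 · s(f). -/

import Mathlib

open scoped Classical

namespace QCPaper

/-- A partial assignment `c` is consistent with the input `x` if it agrees with `x`
wherever it is defined. -/
def Consistent {n M : ℕ} (c : Fin n → Option (Fin M)) (x : Fin n → Fin M) : Prop :=
  ∀ i : Fin n, ∀ a : Fin M, c i = some a → x i = a

/-- The size of a partial assignment: the number of indices where it is defined. -/
def paSize {n M : ℕ} (c : Fin n → Option (Fin M)) : ℕ :=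
  (Finset.univ.filter fun i => c i ≠ none).card

/-- `c` is a certificate for the partial function `f` with promise `X`:
all inputs in `X` consistent with `c` get the same value under `f`. -/
def IsCertificate {n M : ℕ} (X : Set (Fin n → Fin M)) (f : (Fin n → Fin M) → Bool)
    (c : Fin n → Option (Fin M)) : Prop :=
  ∀ x ∈ X, ∀ y ∈ X, Consistent c x → Consistent c y → f x = f y

/-- The certificate complexity of `f` at the input `x`:
the least size of a certificate for `f` consistent with `x`. -/
noncomputable def Cx {n M : ℕ} (X : Set (Fin n → Fin M)) (f : (Fin n → Fin M) → Bool)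
    (x : Fin n → Fin M) : ℕ :=
  sInf {k | ∃ c : Fin n → Option (Fin M),
    IsCertificate X f c ∧ Consistent c x ∧ paSize c = k}

/-- The certificate complexity `C(f)`: the maximum of `Cx` over inputs in the promise. -/
noncomputable def certC {n M : ℕ} (X : Set (Fin n → Fin M))
    (f : (Fin n → Fin M) → Bool) : ℕ :=
  sSup {k | ∃ x ∈ X, Cx X f x = k}

/-- `b` is a sensitive block of `x` for `f` (with promise `X`). -/
def SensBlock {n M : ℕ} (X : Set (Fin n → Fin M)) (f : (Fin n → Fin M) → Bool)
    (x : Fin n → Fin M) (b : Finset (Fin n)) : Prop :=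
  ∃ y ∈ X, f y ≠ f x ∧ ∀ i : Fin n, y i ≠ x i → i ∈ b

/-- The block sensitivity of `f` at `x`: the largest number of pairwise disjoint
sensitive blocks of `x`. -/
noncomputable def bsx {n M : ℕ} (X : Set (Fin n → Fin M)) (f : (Fin n → Fin M) → Bool)
    (x : Fin n → Fin M) : ℕ :=
  sSup {m | ∃ b : Fin m → Finset (Fin n),
    (∀ j, SensBlock X f x (b j)) ∧ ∀ j j', j ≠ j' → Disjoint (b j) (b j')}

/-- The block sensitivity `bs(f)`. -/
noncomputable def bs {n M : ℕ} (X : Set (Fin n → Fin M))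
    (f : (Fin n → Fin M) → Bool) : ℕ :=
  sSup {m | ∃ x ∈ X, bsx X f x = m}

/-- The sensitivity of `f` at `x`: the largest number of pairwise disjoint
sensitive blocks of `x`, each of size 2. -/
noncomputable def sx {n M : ℕ} (X : Set (Fin n → Fin M)) (f : (Fin n → Fin M) → Bool)
    (x : Fin n → Fin M) : ℕ :=
  sSup {m | ∃ b : Fin m → Finset (Fin n),
    (∀ j, SensBlock X f x (b j) ∧ (b j).card = 2) ∧ ∀ j j', j ≠ j' → Disjoint (b j) (b j')}

/-- The sensitivity `s(f)`. -/
noncomputable def sens {n M : ℕ} (X : Set (Fin n → Fin M))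
    (f : (Fin n → Fin M) → Bool) : ℕ :=
  sSup {m | ∃ x ∈ X, sx X f x = m}

/-- The type of an input: the multiset of its entries. -/
def typeOf {n M : ℕ} (x : Fin n → Fin M) : Multiset (Fin M) :=
  Finset.univ.val.map x

/-- The multiplicity of the alphabet element `a` in the input `x`. -/
def mult {n M : ℕ} (x : Fin n → Fin M) (a : Fin M) : ℕ :=
  (Finset.univ.filter fun i => x i = a).card

/-- A type promise: the (nonempty) set of all strings with one fixed type. -/
def IsTypePromise {n M : ℕ} (T : Set (Fin n → Fin M)) : Prop :=
  ∃ x₀ : Fin n → Fin M, T = {x | typeOf x = typeOf x₀}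

/-- Decision trees over `[M]^n`: either a leaf with a Boolean answer, or a query
to an index together with a subtree for each possible answer. -/
inductive DTree (n M : ℕ) : Type
  | leaf : Bool → DTree n M
  | node : Fin n → (Fin M → DTree n M) → DTree n M

/-- Evaluation of a decision tree on an input. -/
def DTree.eval {n M : ℕ} : DTree n M → (Fin n → Fin M) → Bool
  | .leaf b, _ => b
  | .node i ts, x => (ts (x i)).eval x

/-- The cost of a decision tree on an input: the number of queries made. -/
def DTree.cost {n M : ℕ} : DTree n M → (Fin n → Fin M) → ℕ
  | .leaf _, _ => 0
  | .node i ts, x => (ts (x i)).cost x + 1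

/-- The depth of a decision tree: its maximum cost over all inputs. -/
def DTree.depth {n M : ℕ} : DTree n M → ℕ
  | .leaf _ => 0
  | .node _ ts => (Finset.univ.sup fun a => (ts a).depth) + 1

/-- The tree `t` computes `f` on the promise `X`. -/
def Computes {n M : ℕ} (X : Set (Fin n → Fin M)) (f : (Fin n → Fin M) → Bool)
    (t : DTree n M) : Prop :=
  ∀ x ∈ X, t.eval x = f x

/-- The deterministic query complexity `D(f)`:
the least depth of a decision tree computing `f`. -/
noncomputable def detD {n M : ℕ} (X : Set (Fin n → Fin M))
    (f : (Fin n → Fin M) → Bool) : ℕ :=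
  sInf {d | ∃ t : DTree n M, Computes X f t ∧ t.depth = d}

/-- A finitely supported probability distribution over decision trees,
given as a finite list of trees with probabilities. -/
structure RandAlg (n M : ℕ) where
  N : ℕ
  tree : Fin N → DTree n M
  prob : Fin N → ℝ
  nonneg : ∀ j, 0 ≤ prob j
  sum_one : ∑ j, prob j = 1

/-- The expected cost of a randomized algorithm on the input `x`. -/
noncomputable def expCost {n M : ℕ} (A : RandAlg n M) (x : Fin n → Fin M) : ℝ :=
  ∑ j, A.prob j * ((A.tree j).cost x : ℝ)

/-- `A` is a zero-error randomized algorithm for `f`: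
every tree in its support computes `f`. -/
def ZeroError {n M : ℕ} (X : Set (Fin n → Fin M)) (f : (Fin n → Fin M) → Bool)
    (A : RandAlg n M) : Prop :=
  ∀ j, A.prob j ≠ 0 → Computes X f (A.tree j)

/-- The cost of a randomized algorithm: the maximum over inputs in the promise of
the expected cost. -/
noncomputable def algCost {n M : ℕ} (X : Set (Fin n → Fin M)) (A : RandAlg n M) : ℝ :=
  sSup {r | ∃ x ∈ X, r = expCost A x}

/-- The zero-error randomized query complexity `R₀(f)`:
the infimum cost of a zero-error randomized algorithm for `f`. -/
noncomputable def R0 {n M : ℕ} (X : Set (Fin n → Fin M))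
    (f : (Fin n → Fin M) → Bool) : ℝ :=
  sInf {r | ∃ A : RandAlg n M, ZeroError X f A ∧ algCost X A = r}

/-- `A` is a bounded-error randomized algorithm for `f`: on every input in the promise,
it returns the correct answer with probability at least 2/3. -/
def BoundedError {n M : ℕ} (X : Set (Fin n → Fin M)) (f : (Fin n → Fin M) → Bool)
    (A : RandAlg n M) : Prop :=
  ∀ x ∈ X, (2/3 : ℝ) ≤ ∑ j ∈ Finset.univ.filter fun j => (A.tree j).eval x = f x, A.prob j

/-- The depth of a randomized algorithm: the maximum depth of a tree in its support. -/
noncomputable def suppDepth {n M : ℕ} (A : RandAlg n M) : ℕ :=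
  (Finset.univ.filter fun j => A.prob j ≠ 0).sup fun j => (A.tree j).depth

/-- The bounded-error randomized query complexity `R(f)`:
the least depth of a bounded-error randomized algorithm for `f`. -/
noncomputable def randR {n M : ℕ} (X : Set (Fin n → Fin M))
    (f : (Fin n → Fin M) → Bool) : ℕ :=
  sInf {d | ∃ A : RandAlg n M, BoundedError X f A ∧ suppDepth A = d}

/-- A set of inputs is symmetric if it is invariant under permuting coordinates. -/
def SymmetricSet {n M : ℕ} (X : Set (Fin n → Fin M)) : Prop :=
  ∀ x ∈ X, ∀ σ : Equiv.Perm (Fin n), (x ∘ σ) ∈ X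

/-- A function is symmetric if its value depends only on the type of the input. -/
def SymmetricFun {n M : ℕ} (X : Set (Fin n → Fin M))
    (f : (Fin n → Fin M) → Bool) : Prop :=
  ∀ x ∈ X, ∀ y ∈ X, typeOf x = typeOf y → f x = f y

/-- The measure `d(f)` for a non-constant symmetric function: the least distance between
the types of two inputs in the promise with different values under `f`. -/
noncomputable def dgap {n M : ℕ} (X : Set (Fin n → Fin M))
    (f : (Fin n → Fin M) → Bool) : ℕ :=
  sInf {d | ∃ x ∈ X, ∃ y ∈ X, f x ≠ f y ∧
    (Finset.univ.sup fun a => Nat.dist (mult x a) (mult y a)) = d}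

theorem typeOf_comp_perm {n M : ℕ} (x : Fin n → Fin M) (σ : Equiv.Perm (Fin n)) :
    typeOf (x ∘ σ) = typeOf x := by
  unfold typeOf
  rw [← Multiset.map_map, ← Equiv.coe_toEmbedding, ← Finset.map_val, Finset.map_univ_equiv]

theorem count_typeOf {n M : ℕ} (x : Fin n → Fin M) (a : Fin M) :
    (typeOf x).count a = mult x a := by
  simp only [typeOf, mult, Multiset.count_map, Finset.card_def, Finset.filter_val, eq_comm]

/-- Two inputs of the same type that agree outside `b` differ by a permutation of `b`. -/
theorem exists_perm_of_typeOf_eq {n M : ℕ} {x y : Fin n → Fin M} {b : Finset (Fin n)}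
    (h : typeOf y = typeOf x) (hb : ∀ i ∉ b, y i = x i) :
    ∃ σ : Equiv.Perm b, ∀ i : b, x (σ i) = y i := by
  have hcard (c : Fin M) : (b.filter fun i => y i = c).card = (b.filter fun i => x i = c).card := by
    have hm : mult y c = mult x c := by rw [← count_typeOf, ← count_typeOf, h]
    have hsplit (z : Fin n → Fin M) :
        mult z c = (b.filter fun i => z i = c).card + (bᶜ.filter fun i => z i = c).card := by
      rw [mult, ← Finset.card_union_of_disjoint, ← Finset.filter_union, Finset.union_compl]
      exact Finset.disjoint_filter_filter disjoint_compl_right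
    have hout : (bᶜ.filter fun i => y i = c) = bᶜ.filter fun i => x i = c :=
      Finset.filter_congr fun i hi => by rw [hb i (Finset.mem_compl.1 hi)]
    rw [hsplit y, hsplit x, hout] at hm
    exact Nat.add_right_cancel hm
  have hfiber (z : Fin n → Fin M) (c : Fin M) :
      Fintype.card {i : b // z i = c} = (b.filter fun i => z i = c).card := by
    rw [Fintype.card_subtype, ← Finset.card_map (Function.Embedding.subtype _)]
    congr 1
    ext i
    simp [and_comm]
  have hequiv (c : Fin M) : Nonempty ({i : b // y i = c} ≃ {i : b // x i = c}) :=
    Fintype.card_eq.1 (by rw [hfiber, hfiber, hcard])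
  exact ⟨Equiv.ofFiberEquiv (f := fun i : b => y i) (g := fun i : b => x i)
    fun c => (hequiv c).some, fun i =>
      Equiv.ofFiberEquiv_map (f := fun i : b => y i) (g := fun i : b => x i) _ i⟩

/-- The graph joining `i` to `σ i` has maximum degree two, so a maximal independent set
contains at least a third of the points. -/
theorem exists_independent_of_fixedPointFree {α : Type*} [Fintype α] (σ : Equiv.Perm α)
    (hσ : ∀ i, σ i ≠ i) :
    ∃ S : Finset α, (∀ i ∈ S, σ i ∉ S) ∧ Fintype.card α ≤ 3 * S.card := by
  obtain ⟨S, hS⟩ := (Set.toFinite {S : Finset α | ∀ i ∈ S, σ i ∉ S}).exists_maximal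
    ⟨∅, by simp⟩
  have hind : ∀ i ∈ S, σ i ∉ S := hS.prop
  refine ⟨S, hind, ?_⟩
  have hcover : (Finset.univ : Finset α) ⊆ S ∪ (S.image σ ∪ S.image σ.symm) := by
    intro i _
    by_contra hi
    simp only [Finset.mem_union, Finset.mem_image, not_or, not_exists, not_and] at hi
    obtain ⟨hiS, hout, hin⟩ := hi
    have hσi : σ i ∉ S := fun h => hin _ h (σ.symm_apply_apply i)
    have hins : ∀ j ∈ insert i S, σ j ∉ insert i S := by
      intro j hj hσj
      rcases Finset.mem_insert.1 hj with rfl | hj <;>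
        rcases Finset.mem_insert.1 hσj with h | h
      · exact hσ _ h
      · exact hσi h
      · exact hout j hj h
      · exact hind j hj h
    exact hiS (hS.le_of_ge hins (Finset.subset_insert i S) (Finset.mem_insert_self i S))
  have h₁ := Finset.card_le_card hcover
  have h₂ := Finset.card_union_le S (S.image σ ∪ S.image σ.symm)
  have h₃ := Finset.card_union_le (S.image σ) (S.image σ.symm)
  have h₄ := Finset.card_image_le (s := S) (f := σ)
  have h₅ := Finset.card_image_le (s := S) (f := σ.symm)
  rw [Finset.card_univ] at h₁
  omega

theorem le_sens {n M m : ℕ} {X : Set (Fin n → Fin M)} {f : (Fin n → Fin M) → Bool}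
    {x : Fin n → Fin M} (hx : x ∈ X) (b : Fin m → Finset (Fin n))
    (hb : ∀ j, SensBlock X f x (b j) ∧ (b j).card = 2)
    (hdisj : ∀ j j', j ≠ j' → Disjoint (b j) (b j')) : m ≤ sens X f := by
  have hsx : m ≤ sx X f x := by
    refine le_csSup ⟨Fintype.card (Finset (Fin n)), ?_⟩ ⟨b, hb, hdisj⟩
    rintro k ⟨c, hc, hcd⟩
    have hinj : Function.Injective c := by
      intro j j' hjj'
      by_contra hne
      have hd := hcd j j' hne
      rw [← hjj', disjoint_self] at hd
      have h2 := (hc j).2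
      simp [hd] at h2
    simpa using Fintype.card_le_of_injective c hinj
  exact hsx.trans (le_csSup ((Set.toFinite X).image (sx X f)).bddAbove ⟨x, hx, rfl⟩)

/-- on a type promise, any inclusion-minimal sensitive block of an input
has size at most `3 · s(f)`. -/
theorem minimal_sensBlock_card_le (n M : ℕ) (hn : 1 ≤ n) (hM : 1 ≤ M)
    (T : Set (Fin n → Fin M)) (hT : IsTypePromise T)
    (f : (Fin n → Fin M) → Bool)
    (x : Fin n → Fin M) (hx : x ∈ T)
    (b : Finset (Fin n)) (hb : SensBlock T f x b)
    (hmin : ∀ b' : Finset (Fin n), b' ⊂ b → ¬ SensBlock T f x b') :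
    b.card ≤ 3 * sens T f := by
  obtain ⟨x₀, rfl⟩ := hT
  obtain ⟨y, hy, hfy, hyb⟩ := hb
  have hsame : ∀ z, typeOf z = typeOf x₀ → (∀ i, z i ≠ x i → i ∈ b) →
      ∀ j ∈ b, z j = x j → f z = f x := by
    intro z hz hzb j hj hzj
    by_contra hne
    refine hmin _ (Finset.erase_ssubset hj) ⟨z, hz, hne, fun i hi => ?_⟩
    exact Finset.mem_erase.2 ⟨fun hij => hi (hij ▸ hzj), hzb i hi⟩
  have hne : ∀ i ∈ b, y i ≠ x i := fun i hi h => hfy (hsame y hy hyb i hi h)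
  obtain ⟨σ, hσ⟩ := exists_perm_of_typeOf_eq (hy.trans hx.symm)
    fun i hi => not_not.1 fun h => hi (hyb i h)
  have hfree (i : b) : σ i ≠ i := fun h => hne i i.2 (by rw [← hσ i, h])
  obtain ⟨S, hS, hcard⟩ := exists_independent_of_fixedPointFree σ hfree
  rw [Fintype.card_coe] at hcard
  refine hcard.trans (Nat.mul_le_mul_left 3 ?_)
  let e := S.equivFin.symm
  refine le_sens hy (fun j => {((e j : b) : Fin n), (σ (e j) : Fin n)}) (fun j => ⟨?_, ?_⟩) ?_
  · generalize (e j : b) = i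
    have hz : typeOf (y ∘ Equiv.swap (i : Fin n) (σ i)) = typeOf x₀ :=
      (typeOf_comp_perm _ _).trans hy
    have hfix : ∀ k, k ≠ (i : Fin n) → k ≠ σ i → (y ∘ Equiv.swap (i : Fin n) (σ i)) k = y k :=
      fun k h₁ h₂ => by rw [Function.comp_apply, Equiv.swap_apply_of_ne_of_ne h₁ h₂]
    refine ⟨_, hz, ?_, fun k hk => ?_⟩
    · rw [hsame _ hz (fun k hk => ?_) (σ i) (σ i).2 (by simp [hσ i])]
      · exact hfy.symm
      · by_contra hkb
        rw [hfix k (fun h => hkb (h ▸ i.2)) fun h => hkb (h ▸ (σ i).2)] at hk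
        exact hkb (hyb k hk)
    · by_contra hk'
      simp only [Finset.mem_insert, Finset.mem_singleton, not_or] at hk'
      exact hk (hfix k hk'.1 hk'.2)
  · exact Finset.card_pair fun h => hfree _ (Subtype.ext h.symm)
  · intro j j' hjj'
    have hjj : (e j : b) ≠ e j' := fun h => hjj' (e.injective (Subtype.ext h))
    have h₁ : σ (e j) ≠ e j' := fun h => hS _ (e j).2 (h ▸ (e j').2)
    have h₂ : σ (e j') ≠ e j := fun h => hS _ (e j').2 (h ▸ (e j).2)
    have h₃ : σ (e j) ≠ σ (e j') := fun h => hjj (σ.injective h)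
    simp [Finset.disjoint_left, hjj, h₁, h₂.symm, h₃]

end QCPaper
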